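/- For every a > 0 and every n ≥ 1, the n-th moment of the Marchenko–Pastur distribution with parameter a equals Σ_π a^{o(π)}, where the sum is over all noncrossing pairings π of {1,…,2n} and o(π) is the number of blocks of π whose minimal element is odd. -/

import Mathlib

open MeasureTheory Finset Real

/-- `P` is a set partition of the finite set `s ⊆ ℕ`, encoded as a finite set of blocks. -/
def IsPartitionOf (s : Finset ℕ) (P : Finset (Finset ℕ)) : Prop :=
  (∀ B ∈ P, B ⊆ s) ∧ (∀ B ∈ P, B.Nonempty) ∧ (∀ x ∈ s, ∃ B ∈ P, x ∈ B) ∧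
  (∀ B ∈ P, ∀ C ∈ P, ∀ x ∈ B, x ∈ C → B = C)

/-- A partition is noncrossing if there are no `i < j < k < l` with `i, k` in one block and
`j, l` in a different block. -/
def IsNoncrossing (P : Finset (Finset ℕ)) : Prop :=
  ¬ ∃ B ∈ P, ∃ C ∈ P, B ≠ C ∧
      ∃ i ∈ B, ∃ j ∈ C, ∃ k ∈ B, ∃ l ∈ C, i < j ∧ j < k ∧ k < l

/-- A pairing is a partition all of whose blocks have exactly two elements. -/
def IsPairing (P : Finset (Finset ℕ)) : Prop := ∀ B ∈ P, B.card = 2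

instance (s : Finset ℕ) : DecidablePred (fun P => IsPartitionOf s P ∧ IsPairing P ∧
    IsNoncrossing P) := fun P => by
  unfold IsPartitionOf IsPairing IsNoncrossing; infer_instance

/-- The finite set of all noncrossing pairings of `{1, …, m}`. -/
def ncPairings (m : ℕ) : Finset (Finset (Finset ℕ)) :=
  ((Finset.Icc 1 m).powerset.powerset).filter
    (fun P => IsPartitionOf (Finset.Icc 1 m) P ∧ IsPairing P ∧ IsNoncrossing P)

/-- `m` is the minimum of the block `B` and is odd. -/
def oddMin (B : Finset ℕ) : Prop := ∃ m ∈ B, Odd m ∧ ∀ x ∈ B, m ≤ x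

instance : DecidablePred oddMin := fun B => by unfold oddMin; infer_instance

/-- `o(P)`: the number of blocks of `P` whose minimal element is odd. -/
def oCount (P : Finset (Finset ℕ)) : ℕ := (P.filter oddMin).card

/-- The density of the Marchenko–Pastur distribution with parameter `a`. -/
noncomputable def mpDensity (a : ℝ) (x : ℝ) : ℝ :=
  if (1 - Real.sqrt a)^2 ≤ x ∧ x ≤ (1 + Real.sqrt a)^2 then
    Real.sqrt (4*a - (x - 1 - a)^2) / (2 * Real.pi * x)
  else 0

/-- The Marchenko–Pastur distribution with parameter `a > 0` (with an atom `1-a` at `0`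
when `a < 1`; for `a ≥ 1` the atom has zero mass). -/
noncomputable def MP (a : ℝ) : Measure ℝ :=
  (ENNReal.ofReal (1 - a)) • Measure.dirac 0 +
    volume.withDensity (fun x => ENNReal.ofReal (mpDensity a x))

/-- The noncrossing pairings of a finite set of natural numbers. -/
def ncPairingsOn (s : Finset ℕ) : Finset (Finset (Finset ℕ)) :=
  s.powerset.powerset.filter (fun P => IsPartitionOf s P ∧ IsPairing P ∧ IsNoncrossing P)

lemma mem_ncPairingsOn {s : Finset ℕ} {P : Finset (Finset ℕ)} :
    P ∈ ncPairingsOn s ↔ IsPartitionOf s P ∧ IsPairing P ∧ IsNoncrossing P := by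
  simp only [ncPairingsOn, Finset.mem_filter, Finset.mem_powerset, and_iff_right_iff_imp]
  rintro ⟨h, -⟩ B hB
  exact Finset.mem_powerset.2 (h.1 B hB)

lemma insert_union_mem_ncPairingsOn {c k d : ℕ} (hck : c < k) (hkd : k < d)
    {Q R : Finset (Finset ℕ)} (hQ : Q ∈ ncPairingsOn (Ico (c + 1) k))
    (hR : R ∈ ncPairingsOn (Ico (k + 1) d)) :
    insert {c, k} (Q ∪ R) ∈ ncPairingsOn (Ico c d) := by
  rw [mem_ncPairingsOn] at *
  obtain ⟨⟨hQ1, hQ2, hQ3, hQ4⟩, hQ5, hQ6⟩ := hQ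
  obtain ⟨⟨hR1, hR2, hR3, hR4⟩, hR5, hR6⟩ := hR
  have hQ7 : ∀ B ∈ Q, ∀ x ∈ B, c < x ∧ x < k := fun B hB x hx => by
    have := hQ1 B hB hx
    simp only [Finset.mem_Ico] at this; omega
  have hR7 : ∀ B ∈ R, ∀ x ∈ B, k < x ∧ x < d := fun B hB x hx => by
    have := hR1 B hB hx
    simp only [Finset.mem_Ico] at this; omega
  simp only [Finset.mem_Ico] at hQ3 hR3
  refine ⟨⟨?_, ?_, ?_, ?_⟩, ?_, ?_⟩
  · intro B hB x hx
    simp only [Finset.mem_insert, Finset.mem_union, Finset.mem_Ico] at *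
    grind
  · intro B hB
    simp only [Finset.mem_insert, Finset.mem_union] at hB
    rcases hB with rfl | hB | hB
    · exact ⟨c, by simp⟩
    · exact hQ2 B hB
    · exact hR2 B hB
  · intro x hx
    simp only [Finset.mem_Ico] at hx
    rcases lt_trichotomy x k with h | h | h
    · rcases hx.1.eq_or_lt with h' | h'
      · exact ⟨{c, k}, by simp, by simp [h']⟩
      · obtain ⟨B, hB, hxB⟩ := hQ3 x (by omega)
        exact ⟨B, by simp [hB], hxB⟩
    · exact ⟨{c, k}, by simp, by simp [h]⟩
    · obtain ⟨B, hB, hxB⟩ := hR3 x (by omega)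
      exact ⟨B, by simp [hB], hxB⟩
  · intro B hB C hC x hxB hxC
    simp only [Finset.mem_insert, Finset.mem_union] at hB hC
    grind
  · intro B hB
    simp only [Finset.mem_insert, Finset.mem_union] at hB
    rcases hB with rfl | hB | hB
    · exact Finset.card_pair hck.ne
    · exact hQ5 B hB
    · exact hR5 B hB
  · rintro ⟨B, hB, C, hC, hBC, i, hi, j, hj, p, hp, l, hl, hij, hjp, hpl⟩
    simp only [Finset.mem_insert, Finset.mem_union] at hB hC
    rcases hB with rfl | hB | hB <;> rcases hC with rfl | hC | hC
    · exact hBC rfl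
    · have := hQ7 C hC l hl; simp only [Finset.mem_insert, Finset.mem_singleton] at hi hp; omega
    · have := hR7 C hC j hj; simp only [Finset.mem_insert, Finset.mem_singleton] at hi hp; omega
    · have := hQ7 B hB i hi; have := hQ7 B hB p hp
      simp only [Finset.mem_insert, Finset.mem_singleton] at hj hl; omega
    · exact hQ6 ⟨B, hB, C, hC, hBC, i, hi, j, hj, p, hp, l, hl, hij, hjp, hpl⟩
    · have := hQ7 B hB p hp; have := hR7 C hC j hj; omega
    · have := hR7 B hB i hi; simp only [Finset.mem_insert, Finset.mem_singleton] at hj hl; omega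
    · have := hR7 B hB i hi; have := hQ7 C hC l hl; omega
    · exact hR6 ⟨B, hB, C, hC, hBC, i, hi, j, hj, p, hp, l, hl, hij, hjp, hpl⟩

lemma filter_subset_insert_union {c k d : ℕ} {Q R : Finset (Finset ℕ)}
    (hQ : Q ∈ ncPairingsOn (Ico (c + 1) k)) (hR : R ∈ ncPairingsOn (Ico (k + 1) d)) :
    (insert {c, k} (Q ∪ R)).filter (· ⊆ Ico (c + 1) k) = Q ∧
      (insert {c, k} (Q ∪ R)).filter (· ⊆ Ico (k + 1) d) = R := by
  rw [mem_ncPairingsOn] at *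
  obtain ⟨⟨hQ1, hQ2, -, -⟩, -⟩ := hQ
  obtain ⟨⟨hR1, hR2, -, -⟩, -⟩ := hR
  have hQR : ∀ B : Finset ℕ, B.Nonempty → B ⊆ Ico (c + 1) k → B ⊆ Ico (k + 1) d → False := by
    rintro B ⟨x, hx⟩ h1 h2
    have h1 := h1 hx
    have h2 := h2 hx
    simp only [Finset.mem_Ico] at h1 h2
    omega
  have hk1 : ¬ ({c, k} : Finset ℕ) ⊆ Ico (c + 1) k := fun h => by
    have := h (show k ∈ ({c, k} : Finset ℕ) by simp); simp at this
  have hk2 : ¬ ({c, k} : Finset ℕ) ⊆ Ico (k + 1) d := fun h => by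
    have := h (show k ∈ ({c, k} : Finset ℕ) by simp); simp at this
  constructor <;> ext B <;> simp only [Finset.mem_filter, Finset.mem_insert, Finset.mem_union]
  · constructor
    · rintro ⟨rfl | hB | hB, h⟩
      · exact (hk1 h).elim
      · exact hB
      · exact (hQR B (hR2 B hB) h (hR1 B hB)).elim
    · exact fun hB => ⟨Or.inr (Or.inl hB), hQ1 B hB⟩
  · constructor
    · rintro ⟨rfl | hB | hB, h⟩
      · exact (hk2 h).elim
      · exact (hQR B (hQ2 B hB) (hQ1 B hB) h).elim
      · exact hB
    · exact fun hB => ⟨Or.inr (Or.inr hB), hR1 B hB⟩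

lemma exists_eq_insert_union {c d : ℕ} (hcd : c < d) {P : Finset (Finset ℕ)}
    (hP : P ∈ ncPairingsOn (Ico c d)) :
    ∃ k, c < k ∧ k < d ∧ ∃ Q ∈ ncPairingsOn (Ico (c + 1) k), ∃ R ∈ ncPairingsOn (Ico (k + 1) d),
      insert {c, k} (Q ∪ R) = P := by
  rw [mem_ncPairingsOn] at hP
  obtain ⟨⟨hP1, hP2, hP3, hP4⟩, hP5, hP6⟩ := hP
  have hP7 : ∀ B ∈ P, ∀ x ∈ B, c ≤ x ∧ x < d := fun B hB x hx => by
    simpa only [Finset.mem_Ico] using hP1 B hB hx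
  obtain ⟨A, hA, hcA⟩ := hP3 c (by simp [hcd])
  obtain ⟨k, hk⟩ : ∃ k, A = {c, k} := by
    obtain ⟨x, y, -, rfl⟩ := Finset.card_eq_two.1 (hP5 A hA)
    simp only [Finset.mem_insert, Finset.mem_singleton] at hcA
    rcases hcA with rfl | rfl
    · exact ⟨y, rfl⟩
    · exact ⟨x, Finset.pair_comm _ _⟩
  subst hk
  have hkne : c ≠ k := by
    rintro rfl
    simpa using hP5 _ hA
  have hkP := hP7 _ hA k (by simp)
  have hck : c < k := by omega
  have hother : ∀ B ∈ P, B ≠ {c, k} → c ∉ B ∧ k ∉ B := fun B hB hne =>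
    ⟨fun h => hne (hP4 B hB _ hA c h (by simp)), fun h => hne (hP4 B hB _ hA k h (by simp))⟩
  have hsplit : ∀ B ∈ P, B ≠ {c, k} → B ⊆ Ico (c + 1) k ∨ B ⊆ Ico (k + 1) d := by
    intro B hB hne
    obtain ⟨hc, hk⟩ := hother B hB hne
    by_contra! hcon
    obtain ⟨⟨x, hx, hx'⟩, ⟨y, hy, hy'⟩⟩ := hcon.imp Finset.not_subset.1 Finset.not_subset.1
    have hx1 := hP7 B hB x hx
    have hy1 := hP7 B hB y hy
    have hxc : x ≠ c := fun h => hc (h ▸ hx)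
    have hxk : x ≠ k := fun h => hk (h ▸ hx)
    have hyc : y ≠ c := fun h => hc (h ▸ hy)
    have hyk : y ≠ k := fun h => hk (h ▸ hy)
    simp only [Finset.mem_Ico] at hx' hy'
    exact hP6 ⟨_, hA, B, hB, hne.symm, c, by simp, y, hy, k, by simp, x, hx,
      by omega, by omega, by omega⟩
  have hsub : ∀ s : Finset ℕ, s ⊆ Ico c d →
      (∀ x ∈ s, ∀ B ∈ P, x ∈ B → B ⊆ s) → P.filter (· ⊆ s) ∈ ncPairingsOn s := by
    intro s hs hcov
    rw [mem_ncPairingsOn]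
    refine ⟨⟨fun B hB => (Finset.mem_filter.1 hB).2, fun B hB => hP2 B (Finset.mem_filter.1 hB).1,
      fun x hx => ?_, fun B hB C hC => hP4 B (Finset.mem_filter.1 hB).1 C (Finset.mem_filter.1 hC).1⟩,
      fun B hB => hP5 B (Finset.mem_filter.1 hB).1, ?_⟩
    · obtain ⟨B, hB, hxB⟩ := hP3 x (hs hx)
      exact ⟨B, Finset.mem_filter.2 ⟨hB, hcov x hx B hB hxB⟩, hxB⟩
    · rintro ⟨B, hB, C, hC, h⟩
      exact hP6 ⟨B, (Finset.mem_filter.1 hB).1, C, (Finset.mem_filter.1 hC).1, h⟩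
  refine ⟨k, hck, hkP.2, P.filter (· ⊆ Ico (c + 1) k), hsub _ ?_ ?_,
    P.filter (· ⊆ Ico (k + 1) d), hsub _ ?_ ?_, ?_⟩
  · exact Finset.Ico_subset_Ico (by omega) (by omega)
  · intro x hx B hB hxB
    simp only [Finset.mem_Ico] at hx
    have hne : B ≠ {c, k} := by
      rintro rfl
      simp only [Finset.mem_insert, Finset.mem_singleton] at hxB
      omega
    refine (hsplit B hB hne).resolve_right fun h => ?_
    have := Finset.mem_Ico.1 (h hxB)
    omega
  · exact Finset.Ico_subset_Ico (by omega) (by omega)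
  · intro x hx B hB hxB
    simp only [Finset.mem_Ico] at hx
    have hne : B ≠ {c, k} := by
      rintro rfl
      simp only [Finset.mem_insert, Finset.mem_singleton] at hxB
      omega
    refine (hsplit B hB hne).resolve_left fun h => ?_
    have := Finset.mem_Ico.1 (h hxB)
    omega
  · ext B
    simp only [Finset.mem_insert, Finset.mem_union, Finset.mem_filter]
    constructor
    · rintro (rfl | h | h)
      · exact hA
      · exact h.1
      · exact h.1
    · intro hB
      by_cases hne : B = {c, k}
      · exact Or.inl hne
      · exact Or.inr ((hsplit B hB hne).imp (⟨hB, ·⟩) (⟨hB, ·⟩))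

lemma oddMin_pair {c k : ℕ} (hck : c < k) : oddMin {c, k} ↔ Odd c := by
  constructor
  · rintro ⟨m, hm, hodd, hmin⟩
    have := hmin c (by simp)
    simp only [Finset.mem_insert, Finset.mem_singleton] at hm
    rcases hm with rfl | rfl
    · exact hodd
    · omega
  · exact fun h => ⟨c, by simp, h, fun x hx => by
      simp only [Finset.mem_insert, Finset.mem_singleton] at hx; omega⟩

lemma oCount_insert_union {c k d : ℕ} (hck : c < k) {Q R : Finset (Finset ℕ)}
    (hQ : Q ∈ ncPairingsOn (Ico (c + 1) k)) (hR : R ∈ ncPairingsOn (Ico (k + 1) d)) :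
    oCount (insert {c, k} (Q ∪ R)) = (if Odd c then 1 else 0) + (oCount Q + oCount R) := by
  rw [mem_ncPairingsOn] at hQ hR
  have hdisj : Disjoint Q R := Finset.disjoint_left.2 fun B hBQ hBR => by
    obtain ⟨x, hx⟩ := hQ.1.2.1 B hBQ
    have h1 := Finset.mem_Ico.1 (hQ.1.1 B hBQ hx)
    have h2 := Finset.mem_Ico.1 (hR.1.1 B hBR hx)
    omega
  have hnot : ({c, k} : Finset ℕ) ∉ Q ∪ R := by
    rw [Finset.mem_union, not_or]
    constructor <;> intro h
    · have := Finset.mem_Ico.1 (hQ.1.1 _ h (show c ∈ ({c, k} : Finset ℕ) by simp))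
      omega
    · have := Finset.mem_Ico.1 (hR.1.1 _ h (show c ∈ ({c, k} : Finset ℕ) by simp))
      omega
  unfold oCount
  simp only [Finset.filter_insert, oddMin_pair hck, Finset.filter_union]
  rw [← Finset.card_union_of_disjoint (Finset.disjoint_filter_filter hdisj)]
  split_ifs
  · rw [Finset.card_insert_of_notMem, add_comm]
    rw [← Finset.filter_union]
    exact fun h => hnot (Finset.mem_filter.1 h).1
  · rw [zero_add]

/-- The generating polynomial of the number of blocks with odd minimum, over the noncrossing
pairings of `{c, …, d - 1}`. -/
def oddWeight (a : ℝ) (c d : ℕ) : ℝ := ∑ P ∈ ncPairingsOn (Ico c d), a ^ oCount P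

lemma oddWeight_self (a : ℝ) (c : ℕ) : oddWeight a c c = 1 := by
  have : ncPairingsOn (Ico c c) = {∅} := by
    ext P
    rw [mem_ncPairingsOn, Finset.mem_singleton]
    constructor
    · rintro ⟨⟨h1, h2, -⟩, -⟩
      refine Finset.eq_empty_of_forall_notMem fun B hB => ?_
      obtain ⟨x, hx⟩ := h2 B hB
      simpa using h1 B hB hx
    · rintro rfl
      simp [IsPartitionOf, IsPairing, IsNoncrossing]
  rw [oddWeight, this]
  simp [oCount]

lemma oddWeight_eq_sum (a : ℝ) {c d : ℕ} (hcd : c < d) :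
    oddWeight a c d = (if Odd c then a else 1) *
      ∑ k ∈ Ioo c d, oddWeight a (c + 1) k * oddWeight a (k + 1) d := by
  have hprod : ∀ k, oddWeight a (c + 1) k * oddWeight a (k + 1) d =
      ∑ x ∈ ncPairingsOn (Ico (c + 1) k) ×ˢ ncPairingsOn (Ico (k + 1) d),
        a ^ oCount x.1 * a ^ oCount x.2 := fun k =>
    (Finset.sum_mul_sum _ _ _ _).trans
      (Finset.sum_product' _ _ fun Q R => a ^ oCount Q * a ^ oCount R).symm
  simp only [hprod, Finset.mul_sum]
  rw [Finset.sum_sigma', oddWeight]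
  symm
  refine Finset.sum_bij (fun x _ => insert {c, x.1} (x.2.1 ∪ x.2.2)) ?_ ?_ ?_ ?_
  · rintro ⟨k, Q, R⟩ h
    simp only [Finset.mem_sigma, Finset.mem_Ioo, Finset.mem_product] at h
    exact insert_union_mem_ncPairingsOn h.1.1 h.1.2 h.2.1 h.2.2
  · rintro ⟨k, Q, R⟩ h ⟨k', Q', R'⟩ h' heq
    simp only [Finset.mem_sigma, Finset.mem_Ioo, Finset.mem_product] at h h' heq
    have hmem := insert_union_mem_ncPairingsOn h.1.1 h.1.2 h.2.1 h.2.2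
    have hkk : ({c, k} : Finset ℕ) = {c, k'} :=
      (mem_ncPairingsOn.1 hmem).1.2.2.2 _ (by simp) _ (by rw [heq]; simp) c (by simp) (by simp)
    have hk : k = k' := by
      have : k ∈ ({c, k'} : Finset ℕ) := by rw [← hkk]; simp
      simp only [Finset.mem_insert, Finset.mem_singleton] at this
      omega
    subst hk
    obtain ⟨h1, h2⟩ := filter_subset_insert_union h.2.1 h.2.2
    obtain ⟨h1', h2'⟩ := filter_subset_insert_union h'.2.1 h'.2.2
    rw [heq] at h1 h2
    rw [← h1, ← h2, h1', h2']
  · intro P hP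
    obtain ⟨k, hck, hkd, Q, hQ, R, hR, h⟩ := exists_eq_insert_union hcd hP
    exact ⟨⟨k, Q, R⟩, by simp [*], h⟩
  · rintro ⟨k, Q, R⟩ h
    simp only [Finset.mem_sigma, Finset.mem_Ioo, Finset.mem_product] at h
    simp only
    rw [oCount_insert_union h.1.1 h.2.1 h.2.2, pow_add, pow_add]
    split_ifs <;> simp

lemma oddWeight_add_odd (a : ℝ) (n c : ℕ) : oddWeight a c (c + (2 * n + 1)) = 0 := by
  induction n using Nat.strong_induction_on generalizing c with
  | _ n ih =>
  rw [oddWeight_eq_sum a (by omega), Finset.sum_eq_zero, mul_zero]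
  intro k hk
  rw [Finset.mem_Ioo] at hk
  rcases Nat.even_or_odd' (k - c) with ⟨j, hj | hj⟩
  · have h := ih (j - 1) (by omega) (c + 1)
    rw [show c + 1 + (2 * (j - 1) + 1) = k by omega] at h
    rw [h, zero_mul]
  · have h := ih (n - j - 1) (by omega) (k + 1)
    rw [show k + 1 + (2 * (n - j - 1) + 1) = c + (2 * n + 1) by omega] at h
    rw [h, mul_zero]

lemma oddWeight_add_even_succ (a : ℝ) (n c : ℕ) :
    oddWeight a c (c + 2 * (n + 1)) = (if Odd c then a else 1) *
      ∑ p ∈ antidiagonal n, oddWeight a (c + 1) (c + 1 + 2 * p.1) *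
        oddWeight a (c + 2 * p.1 + 2) (c + 2 * p.1 + 2 + 2 * p.2) := by
  rw [oddWeight_eq_sum a (by omega)]
  congr 1
  symm
  refine Finset.sum_of_injOn (fun p => c + 1 + 2 * p.1) ?_ ?_ ?_ ?_
  · rintro ⟨i, j⟩ h ⟨i', j'⟩ h' heq
    simp only [Finset.mem_coe, Finset.HasAntidiagonal.mem_antidiagonal] at h h' heq
    ext <;> simp only <;> omega
  · rintro ⟨i, j⟩ h
    simp only [Finset.mem_coe, Finset.HasAntidiagonal.mem_antidiagonal, Finset.mem_Ioo] at h ⊢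
    omega
  · intro k hk hk'
    rw [Finset.mem_Ioo] at hk
    rcases Nat.even_or_odd' (k - c) with ⟨j, hj | hj⟩
    · have h := oddWeight_add_odd a (j - 1) (c + 1)
      rw [show c + 1 + (2 * (j - 1) + 1) = k by omega] at h
      rw [h, zero_mul]
    · refine (hk' ⟨(j, n - j), ?_, ?_⟩).elim
      · simp only [Finset.mem_coe, Finset.HasAntidiagonal.mem_antidiagonal]; omega
      · simp only; omega
  · rintro ⟨i, j⟩ h
    rw [Finset.HasAntidiagonal.mem_antidiagonal] at h
    simp only at h ⊢
    rw [show c + 1 + 2 * i + 1 = c + 2 * i + 2 by omega,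
      show c + 2 * i + 2 + 2 * j = c + 2 * (n + 1) by omega]

lemma oddWeight_eq_of_recurrence {a : ℝ} {u : ℕ → ℝ} (h0 : u 0 = 1) (h1 : u 1 = 1 + a)
    (hu : ∀ n, u (n + 2) = (1 + a) * u (n + 1) + a * ∑ p ∈ antidiagonal n, u p.1 * u p.2)
    (n c : ℕ) : oddWeight a c (c + 2 * (n + 1)) = (if Odd c then a else 1) * u n := by
  induction n using Nat.strong_induction_on generalizing c with
  | _ n ih =>
  rw [oddWeight_add_even_succ]
  congr 1
  have hodd : ∀ i, Odd (c + 2 * i + 2) ↔ Odd c := fun i => by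
    simp only [Nat.odd_iff]; omega
  have hsucc : Odd (c + 1) ↔ ¬ Odd c := by simp only [Nat.odd_iff]; omega
  have hodd2 : Odd (c + 2) ↔ Odd c := hodd 0
  match n with
  | 0 => simp [oddWeight_self, h0]
  | 1 =>
    rw [Finset.Nat.sum_antidiagonal_succ]
    simp only [Finset.Nat.antidiagonal_zero, Finset.sum_singleton]
    have e1 := ih 0 (by omega) (c + 1)
    have e2 := ih 0 (by omega) (c + 2 * 0 + 2)
    simp only [zero_add, mul_one, mul_zero, add_zero] at e1 e2 ⊢
    simp only [e1, e2, oddWeight_self, h0, h1, hsucc, hodd2]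
    by_cases h : Odd c <;> simp only [h, not_true, not_false_iff, if_true, if_false] <;> ring
  | m + 2 =>
    rw [Finset.Nat.sum_antidiagonal_succ, Finset.Nat.sum_antidiagonal_succ', hu]
    have hmid : ∑ p ∈ antidiagonal m, oddWeight a (c + 1) (c + 1 + 2 * (p.1 + 1)) *
        oddWeight a (c + 2 * (p.1 + 1) + 2) (c + 2 * (p.1 + 1) + 2 + 2 * (p.2 + 1)) =
        a * ∑ p ∈ antidiagonal m, u p.1 * u p.2 := by
      rw [Finset.mul_sum]
      refine Finset.sum_congr rfl fun p hp => ?_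
      rw [Finset.HasAntidiagonal.mem_antidiagonal] at hp
      rw [ih p.1 (by omega), ih p.2 (by omega)]
      simp only [hodd, hsucc]
      by_cases h : Odd c <;> simp only [h, not_true, not_false_iff, if_true, if_false] <;> ring
    rw [hmid]
    have e1 := ih (m + 1) (by omega) (c + 1)
    have e2 := ih (m + 1) (by omega) (c + 2 * 0 + 2)
    simp only [e1, e2, mul_zero, add_zero, oddWeight_self, hodd2, hsucc]
    by_cases h : Odd c <;> simp only [h, not_true, not_false_iff, if_true, if_false] <;> ring

/-- The divided-difference operator `P ↦ (id ⊗ L) ((P(X) - P(Y)) / (X - Y))` attached to a linear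
functional `L` on polynomials. -/
lemma exists_dividedDifference (L : Polynomial ℝ →ₗ[ℝ] ℝ) :
    ∃ D : Polynomial ℝ →ₗ[ℝ] Polynomial ℝ, D 1 = 0 ∧
      ∀ P, D (Polynomial.X * P) = Polynomial.X * D P + Polynomial.C (L P) := by
  let d : ℕ → Polynomial ℝ := fun n => Nat.rec 0
    (fun m e => Polynomial.X * e + Polynomial.C (L (Polynomial.X ^ m))) n
  let D := (Polynomial.basisMonomials ℝ).constr ℝ d
  have hD : ∀ n, D (Polynomial.X ^ n) = d n := fun n => by
    have := (Polynomial.basisMonomials ℝ).constr_basis ℝ d n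
    simp only [Polynomial.coe_basisMonomials] at this
    rwa [Polynomial.monomial_one_right_eq_X_pow n] at this
  refine ⟨D, by rw [← pow_zero Polynomial.X]; exact hD 0, fun P => ?_⟩
  induction P using Polynomial.induction_on' with
  | add p q hp hq => rw [mul_add, map_add, hp, hq, map_add, map_add, map_add]; ring
  | monomial n r =>
    rw [← Polynomial.C_mul_X_pow_eq_monomial, ← Polynomial.smul_eq_C_mul, mul_smul_comm, map_smul,
      map_smul, map_smul, ← pow_succ', hD, hD, mul_smul_comm, ← smul_eq_mul, ← Polynomial.smul_C,
      ← smul_add]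
    simp only [smul_eq_mul]
    rfl

/-- If the moments of `L` satisfy the Catalan-type recurrence of the semicircle law, then those of
its affine images satisfy the weighted Motzkin recurrence. -/
lemma motzkin_recurrence (L : Polynomial ℝ →ₗ[ℝ] ℝ) (h1 : L Polynomial.X = 0)
    (hL : ∀ n, L (Polynomial.X ^ (n + 2)) =
      ∑ p ∈ antidiagonal n, L (Polynomial.X ^ p.1) * L (Polynomial.X ^ p.2))
    (b q : ℝ) (n : ℕ) :
    L ((Polynomial.C b + Polynomial.C q * Polynomial.X) ^ (n + 2)) =
      b * L ((Polynomial.C b + Polynomial.C q * Polynomial.X) ^ (n + 1)) +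
      q ^ 2 * ∑ p ∈ antidiagonal n,
        L ((Polynomial.C b + Polynomial.C q * Polynomial.X) ^ p.1) *
        L ((Polynomial.C b + Polynomial.C q * Polynomial.X) ^ p.2) := by
  obtain ⟨D, hD1, hD⟩ := exists_dividedDifference L
  have hLC : ∀ r P, L (Polynomial.C r * P) = r * L P := fun r P => by
    rw [← Polynomial.smul_eq_C_mul, map_smul, smul_eq_mul]
  have hDC : ∀ r P, D (Polynomial.C r * P) = Polynomial.C r * D P := fun r P => by
    rw [← Polynomial.smul_eq_C_mul, map_smul, Polynomial.smul_eq_C_mul]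
  have hDpow : ∀ (b q : ℝ) (n : ℕ),
      L (D ((Polynomial.C b + Polynomial.C q * Polynomial.X) ^ (n + 1))) =
      q * ∑ p ∈ antidiagonal n,
        L ((Polynomial.C b + Polynomial.C q * Polynomial.X) ^ p.1) *
        L ((Polynomial.C b + Polynomial.C q * Polynomial.X) ^ p.2) := by
    intro b q n
    set Y := Polynomial.C b + Polynomial.C q * Polynomial.X with hY
    have hstep : ∀ P, D (Y * P) = Y * D P + Polynomial.C q * Polynomial.C (L P) := fun P => by
      rw [hY, add_mul, map_add, mul_assoc, hDC, hDC, hD]; ring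
    have hpow : ∀ n, D (Y ^ (n + 1)) =
        ∑ p ∈ antidiagonal n, Polynomial.C (q * L (Y ^ p.2)) * Y ^ p.1 := by
      intro n
      induction n with
      | zero =>
        have := hstep 1
        rw [mul_one, hD1, mul_zero, zero_add] at this
        simp [this]
      | succ n ih =>
        rw [pow_succ', hstep, ih, Finset.Nat.sum_antidiagonal_succ, Finset.mul_sum, add_comm]
        congr 1
        · simp
        · exact Finset.sum_congr rfl fun p _ => by rw [pow_succ]; ring
    rw [hpow, map_sum, Finset.mul_sum]
    exact Finset.sum_congr rfl fun p _ => by rw [hLC]; ring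
  have hSD : ∀ P, L (Polynomial.X * P) = L (D P) := by
    intro P
    induction P using Polynomial.induction_on' with
    | add p q hp hq => rw [mul_add, map_add, hp, hq, map_add, map_add]
    | monomial n r =>
      rw [← Polynomial.C_mul_X_pow_eq_monomial, hDC, hLC, mul_left_comm, hLC, ← pow_succ']
      congr 1
      cases n with
      | zero => simp [h1, hD1]
      | succ n =>
        have := hDpow 0 1 n
        simp only [map_zero, map_one, one_mul, zero_add] at this
        rw [this, hL]
  conv_lhs => rw [pow_succ', add_mul, map_add, hLC, mul_assoc, hLC, hSD, hDpow]
  ring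

/-- The functional `P ↦ (2/π) ∫_0^π P(2 cos θ) sin² θ dθ`, integration against the semicircle
law. -/
noncomputable def semicircleFunctional : Polynomial ℝ →ₗ[ℝ] ℝ where
  toFun P := 2 / π * ∫ θ in (0 : ℝ)..π, P.eval (2 * cos θ) * sin θ ^ 2
  map_add' P Q := by
    have h : ∀ P : Polynomial ℝ, IntervalIntegrable
        (fun θ => P.eval (2 * cos θ) * sin θ ^ 2) volume 0 π := fun P =>
      (by fun_prop : Continuous fun θ => P.eval (2 * cos θ) * sin θ ^ 2).intervalIntegrable _ _
    simp only [Polynomial.eval_add, add_mul]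
    rw [intervalIntegral.integral_add (h P) (h Q), mul_add]
  map_smul' r P := by
    simp only [Polynomial.eval_smul, smul_eq_mul, mul_assoc, RingHom.id_apply]
    rw [intervalIntegral.integral_const_mul]
    ring

lemma semicircleFunctional_apply (P : Polynomial ℝ) : semicircleFunctional P =
    2 / π * ∫ θ in (0 : ℝ)..π, P.eval (2 * cos θ) * sin θ ^ 2 := rfl

lemma semicircleFunctional_X_pow (n : ℕ) : semicircleFunctional (Polynomial.X ^ n) =
    2 ^ (n + 1) / (π * (n + 2)) * ∫ θ in (0 : ℝ)..π, cos θ ^ n := by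
  have h : ∀ θ, (Polynomial.X ^ n : Polynomial ℝ).eval (2 * cos θ) * sin θ ^ 2 =
      2 ^ n * (cos θ ^ n - cos θ ^ (n + 2)) := fun θ => by
    rw [Polynomial.eval_pow, Polynomial.eval_X, sin_sq, mul_pow]; ring
  have hi : ∀ n : ℕ, IntervalIntegrable (fun θ => cos θ ^ n) volume 0 π := fun n =>
    (by fun_prop : Continuous fun θ => cos θ ^ n).intervalIntegrable _ _
  simp only [semicircleFunctional_apply, h]
  rw [intervalIntegral.integral_const_mul, intervalIntegral.integral_sub (hi _) (hi _),
    integral_cos_pow]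
  have : (n : ℝ) + 2 ≠ 0 := by positivity
  simp only [sin_pi, sin_zero]
  field_simp
  ring

lemma semicircleFunctional_X_pow_add_two (n : ℕ) :
    (n + 4) * semicircleFunctional (Polynomial.X ^ (n + 2)) =
      4 * (n + 1) * semicircleFunctional (Polynomial.X ^ n) := by
  rw [semicircleFunctional_X_pow, semicircleFunctional_X_pow, integral_cos_pow]
  have h2 : (n : ℝ) + 2 ≠ 0 := by positivity
  have h4 : (n : ℝ) + 2 + 2 ≠ 0 := by positivity
  simp only [sin_pi, sin_zero]
  push_cast
  field_simp
  ring

lemma semicircleFunctional_X_pow_even (n : ℕ) :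
    semicircleFunctional (Polynomial.X ^ (2 * n)) = catalan n := by
  induction n with
  | zero =>
    rw [semicircleFunctional_X_pow]
    have := pi_ne_zero
    simp
    field_simp
  | succ n ih =>
    have h := semicircleFunctional_X_pow_add_two (2 * n)
    rw [ih] at h
    have h1 : ((n : ℝ) + 1) * catalan n = n.centralBinom := by
      exact_mod_cast succ_mul_catalan_eq_centralBinom n
    have h2 : ((n : ℝ) + 1 + 1) * catalan (n + 1) = (n + 1).centralBinom := by
      exact_mod_cast succ_mul_catalan_eq_centralBinom (n + 1)
    have h3 : ((n : ℝ) + 1) * (n + 1).centralBinom = 2 * (2 * n + 1) * n.centralBinom := by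
      exact_mod_cast Nat.succ_mul_centralBinom_succ n
    rw [← h1, ← h2] at h3
    have h5 : (n : ℝ) + 1 ≠ 0 := by positivity
    have h6 : (n : ℝ) + 2 ≠ 0 := by positivity
    push_cast at h
    rw [show 2 * (n + 1) = 2 * n + 2 by ring]
    apply mul_left_cancel₀ (mul_ne_zero h5 h6)
    linear_combination (n + 1) / 2 * h - h3

lemma semicircleFunctional_X_pow_odd (n : ℕ) :
    semicircleFunctional (Polynomial.X ^ (2 * n + 1)) = 0 := by
  induction n with
  | zero =>
    rw [semicircleFunctional_X_pow]
    simp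
  | succ n ih =>
    have h := semicircleFunctional_X_pow_add_two (2 * n + 1)
    rw [ih, mul_zero] at h
    exact (mul_eq_zero.1 h).resolve_left (by positivity)

lemma semicircleFunctional_recurrence (n : ℕ) : semicircleFunctional (Polynomial.X ^ (n + 2)) =
    ∑ p ∈ antidiagonal n, semicircleFunctional (Polynomial.X ^ p.1) *
      semicircleFunctional (Polynomial.X ^ p.2) := by
  rcases Nat.even_or_odd' n with ⟨m, rfl | rfl⟩
  · rw [show 2 * m + 2 = 2 * (m + 1) by ring, semicircleFunctional_X_pow_even, catalan_succ']
    push_cast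
    refine Finset.sum_of_injOn (fun p => (2 * p.1, 2 * p.2)) ?_ ?_ ?_ ?_
    · rintro ⟨i, j⟩ - ⟨i', j'⟩ - heq
      simp only [Prod.mk.injEq] at heq ⊢
      omega
    · rintro ⟨i, j⟩ h
      simp only [Finset.mem_coe, Finset.HasAntidiagonal.mem_antidiagonal] at h ⊢
      omega
    · rintro ⟨i, j⟩ h h'
      rw [Finset.HasAntidiagonal.mem_antidiagonal] at h
      rcases Nat.even_or_odd' i with ⟨k, rfl | rfl⟩
      · simp only at h
        refine (h' ⟨(k, m - k), ?_, ?_⟩).elim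
        · rw [Finset.mem_coe, Finset.HasAntidiagonal.mem_antidiagonal]
          exact Nat.add_sub_cancel' (by omega)
        · exact Prod.ext rfl (show 2 * (m - k) = j by omega)
      · rw [semicircleFunctional_X_pow_odd, zero_mul]
    · rintro ⟨i, j⟩ -
      rw [semicircleFunctional_X_pow_even, semicircleFunctional_X_pow_even]
  · rw [show 2 * m + 1 + 2 = 2 * (m + 1) + 1 by ring, semicircleFunctional_X_pow_odd,
      Finset.sum_eq_zero]
    rintro ⟨i, j⟩ h
    rw [Finset.HasAntidiagonal.mem_antidiagonal] at h
    rcases Nat.even_or_odd' i with ⟨k, rfl | rfl⟩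
    · obtain ⟨l, rfl⟩ : ∃ l, j = 2 * l + 1 := ⟨m - k, by simp only at h; omega⟩
      rw [semicircleFunctional_X_pow_odd, mul_zero]
    · rw [semicircleFunctional_X_pow_odd, zero_mul]

lemma measurable_mpDensity (a : ℝ) : Measurable (mpDensity a) := by
  refine Measurable.ite (measurableSet_Icc (a := (1 - √a) ^ 2) (b := (1 + √a) ^ 2)) ?_
    measurable_const
  fun_prop

lemma mpDensity_nonneg (a x : ℝ) : 0 ≤ mpDensity a x := by
  unfold mpDensity
  split_ifs with h
  · have : 0 ≤ x := (sq_nonneg _).trans h.1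
    positivity
  · exact le_rfl

lemma mpDensity_mul_pow_succ (a x : ℝ) (n : ℕ) : mpDensity a x * x ^ (n + 1) =
    (Set.Icc ((1 - √a) ^ 2) ((1 + √a) ^ 2)).indicator
      (fun x => x ^ n * √(4 * a - (x - 1 - a) ^ 2) / (2 * π)) x := by
  by_cases h : x ∈ Set.Icc ((1 - √a) ^ 2) ((1 + √a) ^ 2)
  · rw [Set.indicator_of_mem h, mpDensity, if_pos (Set.mem_Icc.1 h)]
    rcases eq_or_ne x 0 with rfl | hx
    · have : √(4 * a - (0 - 1 - a) ^ 2) = 0 :=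
        Real.sqrt_eq_zero_of_nonpos (by nlinarith [sq_nonneg (1 - a)])
      rw [this]
      simp
    · field_simp
      ring
  · rw [Set.indicator_of_notMem h, mpDensity, if_neg (mt Set.mem_Icc.2 h), zero_mul]

lemma integral_pow_succ_MP (a : ℝ) (n : ℕ) : ∫ x, x ^ (n + 1) ∂(MP a) =
    ∫ x in ((1 - √a) ^ 2)..((1 + √a) ^ 2), x ^ n * √(4 * a - (x - 1 - a) ^ 2) / (2 * π) := by
  have hle : (1 - √a) ^ 2 ≤ (1 + √a) ^ 2 := by nlinarith [Real.sqrt_nonneg a]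
  have hmeas : Measurable fun x => ENNReal.ofReal (mpDensity a x) :=
    (measurable_mpDensity a).ennreal_ofReal
  have hdens : ∀ x, (ENNReal.ofReal (mpDensity a x)).toReal • x ^ (n + 1) =
      (Set.Icc ((1 - √a) ^ 2) ((1 + √a) ^ 2)).indicator
        (fun x => x ^ n * √(4 * a - (x - 1 - a) ^ 2) / (2 * π)) x := fun x => by
    rw [ENNReal.toReal_ofReal (mpDensity_nonneg a x), smul_eq_mul, mpDensity_mul_pow_succ]
  have hcont : Continuous fun x : ℝ => x ^ n * √(4 * a - (x - 1 - a) ^ 2) / (2 * π) := by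
    fun_prop
  have hint : Integrable (fun x : ℝ => x ^ (n + 1))
      (volume.withDensity fun x => ENNReal.ofReal (mpDensity a x)) := by
    rw [integrable_withDensity_iff_integrable_smul' hmeas (by simp)]
    simp only [hdens]
    rw [integrable_indicator_iff measurableSet_Icc]
    exact hcont.integrableOn_Icc
  have hdirac : Integrable (fun x : ℝ => x ^ (n + 1))
      (ENNReal.ofReal (1 - a) • Measure.dirac 0) :=
    (integrable_dirac (by simp)).smul_measure ENNReal.ofReal_ne_top
  rw [MP, integral_add_measure hdirac hint, integral_smul_measure, integral_dirac,
    integral_withDensity_eq_integral_toReal_smul hmeas (by simp)]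
  simp only [hdens]
  rw [integral_indicator measurableSet_Icc, intervalIntegral.integral_of_le hle,
    integral_Icc_eq_integral_Ioc]
  simp

lemma integral_pow_succ_MP_eq_semicircleFunctional {a : ℝ} (ha : 0 ≤ a) (n : ℕ) :
    ∫ x, x ^ (n + 1) ∂(MP a) = a * semicircleFunctional
      ((Polynomial.C (1 + a) + Polynomial.C (-√a) * Polynomial.X) ^ n) := by
  have hsq : √a ^ 2 = a := Real.sq_sqrt ha
  rw [integral_pow_succ_MP, semicircleFunctional_apply]
  have hsub := intervalIntegral.integral_comp_mul_deriv
    (f := fun θ => 1 + a - 2 * √a * cos θ) (f' := fun θ => 2 * √a * sin θ) (a := 0) (b := π)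
    (g := fun x => x ^ n * √(4 * a - (x - 1 - a) ^ 2) / (2 * π))
    (fun θ _ => by
      have := ((hasDerivAt_cos θ).const_mul (2 * √a)).const_sub (1 + a)
      simpa using this)
    (by fun_prop) (by fun_prop)
  have e0 : 1 + a - 2 * √a * cos 0 = (1 - √a) ^ 2 := by rw [cos_zero, sub_sq, hsq]; ring
  have e1 : 1 + a - 2 * √a * cos π = (1 + √a) ^ 2 := by rw [cos_pi, add_sq, hsq]; ring
  simp only [e0, e1] at hsub
  rw [← hsub, ← mul_assoc, ← intervalIntegral.integral_const_mul]
  refine intervalIntegral.integral_congr fun θ hθ => ?_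
  rw [Set.uIcc_of_le pi_pos.le] at hθ
  have hsin : 0 ≤ sin θ := sin_nonneg_of_mem_Icc hθ
  have hroot : √(4 * a - (1 + a - 2 * √a * cos θ - 1 - a) ^ 2) = 2 * √a * sin θ := by
    rw [show 4 * a - (1 + a - 2 * √a * cos θ - 1 - a) ^ 2 = (2 * √a * sin θ) ^ 2 by
      rw [mul_pow, sin_sq]; linear_combination -4 * hsq]
    exact Real.sqrt_sq (by positivity)
  simp only [Function.comp_apply, hroot, Polynomial.eval_pow, Polynomial.eval_add,
    Polynomial.eval_mul, Polynomial.eval_C, Polynomial.eval_X]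
  rw [show 1 + a + -√a * (2 * cos θ) = 1 + a - 2 * √a * cos θ by ring]
  have := pi_ne_zero
  field_simp
  linear_combination (1 + a - 2 * √a * cos θ) ^ n * sin θ ^ 2 * hsq

/-- for `a > 0` and `n ≥ 1`, the `n`-th moment of the Marchenko–Pastur
distribution with parameter `a` equals `∑_π a^{o(π)}`, the sum running over all noncrossing
pairings `π` of `{1,…,2n}`. -/
theorem stmt8 (a : ℝ) (ha : 0 < a) (n : ℕ) (hn : 1 ≤ n) :
    ∫ x, x ^ n ∂(MP a) = ∑ P ∈ ncPairings (2 * n), a ^ oCount P := by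
  obtain ⟨n, rfl⟩ : ∃ m, n = m + 1 := ⟨n - 1, by omega⟩
  set u : ℕ → ℝ := fun n => semicircleFunctional
    ((Polynomial.C (1 + a) + Polynomial.C (-√a) * Polynomial.X) ^ n) with hu
  have hX0 : semicircleFunctional 1 = 1 := by
    simpa using semicircleFunctional_X_pow_even 0
  have hX1 : semicircleFunctional Polynomial.X = 0 := by
    simpa using semicircleFunctional_X_pow_odd 0
  have hu1 : u 1 = 1 + a := by
    simp only [hu, pow_one, map_add, ← Polynomial.smul_eq_C_mul, map_smul, hX1]
    rw [← mul_one (Polynomial.C 1), ← mul_one (Polynomial.C a), ← Polynomial.smul_eq_C_mul,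
      ← Polynomial.smul_eq_C_mul, map_smul, map_smul, hX0]
    simp
  have hrec : ∀ n, u (n + 2) =
      (1 + a) * u (n + 1) + a * ∑ p ∈ antidiagonal n, u p.1 * u p.2 := fun n => by
    have h := motzkin_recurrence semicircleFunctional hX1 semicircleFunctional_recurrence
      (1 + a) (-√a) n
    rwa [neg_sq, Real.sq_sqrt ha.le] at h
  have hw := oddWeight_eq_of_recurrence (by simpa [hu] using hX0) hu1 hrec n 1
  rw [if_pos odd_one] at hw
  rw [integral_pow_succ_MP_eq_semicircleFunctional ha.le, ← hw, oddWeight, add_comm 1]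
  rfl
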